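/- For every c > 0 and all nonnegative integers k and ℓ there exists a constant C > 0 such that for all u₀ ∈ L¹(ℝⁿ; ℂᵐ) ∩ L²(ℝⁿ; ℂᵐ) with ∫_{ℝⁿ} |ξ|^{2(k+ℓ)} |𝓕u₀(ξ)|² dξ < ∞, and all t ≥ 0: ∫_{ℝⁿ} |ξ|^{2k} e^{−c η(|ξ|) t} |𝓕u₀(ξ)|² dξ ≤ C (1+t)^{−n/2−k} ‖u₀‖²_{L¹} + C (1+t)^{−ℓ} ∫_{ℝⁿ} |ξ|^{2(k+ℓ)} |𝓕u₀(ξ)|² dξ. (By Plancherel's theorem, combined with the pointwise Fourier estimate |û(t,ξ)| ≤ C e^{−cη(|ξ|)t}|𝓕u₀(ξ)|, this yields the regularity-loss decay estimate ‖∂ₓᵏu(t)‖_{L²} ≤ C(1+t)^{−n/4−k/2}‖u₀‖_{L¹} + C(1+t)^{−ℓ/2}‖∂ₓ^{k+ℓ}u₀‖_{L²}.) -/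

import Mathlib

open Matrix BigOperators Finset

noncomputable section

/-- Complexification of a real matrix. -/
def cmap {a b : ℕ} (X : Matrix (Fin a) (Fin b) ℝ) : Matrix (Fin a) (Fin b) ℂ :=
  X.map (fun x => (x : ℂ))

/-- Real part of the standard Hermitian inner product `⟨x, y⟩ = ∑ xᵢ conj yᵢ` on `ℂᵐ`. -/
def reIP {m : ℕ} (x y : Fin m → ℂ) : ℝ := (∑ i, x i * (starRingEnd ℂ) (y i)).re

/-- Symmetric part `X₁ = (X + Xᵀ)/2` of a real square matrix. -/
def symP {m : ℕ} (X : Matrix (Fin m) (Fin m) ℝ) : Matrix (Fin m) (Fin m) ℝ :=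
  (2⁻¹ : ℝ) • (X + Xᵀ)

/-- Skew-symmetric part `X₂ = (X − Xᵀ)/2` of a real square matrix. -/
def skewP {m : ℕ} (X : Matrix (Fin m) (Fin m) ℝ) : Matrix (Fin m) (Fin m) ℝ :=
  (2⁻¹ : ℝ) • (X - Xᵀ)

/-- Kernel of (the complexification of) a real matrix, as a subset of `ℂᵐ`. -/
def kerC {m : ℕ} (L : Matrix (Fin m) (Fin m) ℝ) : Set (Fin m → ℂ) :=
  {z | (cmap L).mulVec z = 0}

/-- Euclidean norm on `ℂᵐ`. -/
def cnrm {m : ℕ} (z : Fin m → ℂ) : ℝ := Real.sqrt (∑ i, Complex.normSq (z i))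

open MeasureTheory

/-- The Fourier transform `𝓕u₀(ξ) = ∫ e^{−i x·ξ} u₀(x) dx` of `u₀ : ℝⁿ → ℂᵐ`. -/
def FT {n m : ℕ} (u₀ : (Fin n → ℝ) → (Fin m → ℂ)) (ξ : Fin n → ℝ) : Fin m → ℂ :=
  ∫ x : Fin n → ℝ, Complex.exp (-(Complex.I * (∑ j, (x j : ℂ) * (ξ j : ℂ)))) • u₀ x

theorem cnrm_eq_norm_toLp {m : ℕ} (z : Fin m → ℂ) : cnrm z = ‖WithLp.toLp 2 z‖ := by
  simp [cnrm, EuclideanSpace.norm_eq, Complex.normSq_eq_norm_sq]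

theorem cnrm_smul {m : ℕ} (a : ℂ) (z : Fin m → ℂ) : cnrm (a • z) = ‖a‖ * cnrm z := by
  rw [cnrm_eq_norm_toLp, cnrm_eq_norm_toLp, WithLp.toLp_smul, norm_smul]

theorem cnrm_sq {m : ℕ} (z : Fin m → ℂ) : cnrm z ^ 2 = ∑ i, Complex.normSq (z i) :=
  Real.sq_sqrt (Finset.sum_nonneg fun _ _ => Complex.normSq_nonneg _)

/-- The Euclidean norm of an integral is at most the integral of the Euclidean norm. -/
theorem cnrm_integral_le {α : Type*} [MeasurableSpace α] {μ : Measure α} {m : ℕ}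
    (f : α → Fin m → ℂ) : cnrm (∫ x, f x ∂μ) ≤ ∫ x, cnrm (f x) ∂μ := by
  have h := (EuclideanSpace.equiv (Fin m) ℂ).symm.integral_comp_comm (μ := μ) f
  calc cnrm (∫ x, f x ∂μ) = ‖(EuclideanSpace.equiv (Fin m) ℂ).symm (∫ x, f x ∂μ)‖ :=
        cnrm_eq_norm_toLp _
    _ = ‖∫ x, (EuclideanSpace.equiv (Fin m) ℂ).symm (f x) ∂μ‖ := by rw [h]
    _ ≤ ∫ x, ‖(EuclideanSpace.equiv (Fin m) ℂ).symm (f x)‖ ∂μ := norm_integral_le_integral_norm _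
    _ = ∫ x, cnrm (f x) ∂μ := by
        congr 1
        ext x
        exact (cnrm_eq_norm_toLp _).symm

theorem sum_normSq_FT_le {n m : ℕ} (u₀ : (Fin n → ℝ) → (Fin m → ℂ)) (ξ : Fin n → ℝ) :
    ∑ i, Complex.normSq (FT u₀ ξ i) ≤ (∫ x, cnrm (u₀ x)) ^ 2 := by
  rw [← cnrm_sq]
  refine pow_le_pow_left₀ (Real.sqrt_nonneg _) ?_ 2
  refine (cnrm_integral_le _).trans_eq ?_
  congr 1
  ext x
  rw [cnrm_smul]
  have h : -(Complex.I * ∑ j, (x j : ℂ) * (ξ j : ℂ))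
      = ((-∑ j, x j * ξ j : ℝ) : ℂ) * Complex.I := by
    push_cast
    ring
  rw [h, Complex.norm_exp_ofReal_mul_I, one_mul]

theorem pow_mul_exp_neg_mul_le {b x : ℝ} (hb : 0 < b) (hx : 0 ≤ x) (k : ℕ) :
    x ^ k * Real.exp (-(b * x)) ≤ k.factorial / b ^ k := by
  have h := Real.pow_div_factorial_le_exp (b * x) (mul_nonneg hb.le hx) k
  have hk : (0 : ℝ) < k.factorial := by positivity
  rw [div_le_iff₀ hk, mul_pow] at h
  rw [Real.exp_neg, ← div_eq_mul_inv, div_le_div_iff₀ (Real.exp_pos _) (by positivity)]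
  linarith

theorem exp_neg_mul_sum_sq_eq_prod {n : ℕ} (b : ℝ) (ξ : Fin n → ℝ) :
    Real.exp (-(b * ∑ j, ξ j ^ 2)) = ∏ j, Real.exp (-b * ξ j ^ 2) := by
  rw [← Real.exp_sum, ← Finset.mul_sum, neg_mul]

theorem integrable_exp_neg_mul_sum_sq {n : ℕ} {b : ℝ} (hb : 0 < b) :
    Integrable fun ξ : Fin n → ℝ => Real.exp (-(b * ∑ j, ξ j ^ 2)) := by
  simp_rw [exp_neg_mul_sum_sq_eq_prod]
  exact Integrable.fintype_prod fun _ => integrable_exp_neg_mul_sq hb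

theorem integral_exp_neg_mul_sum_sq {n : ℕ} (b : ℝ) :
    ∫ ξ : Fin n → ℝ, Real.exp (-(b * ∑ j, ξ j ^ 2)) = √(Real.pi / b) ^ n := by
  simp_rw [exp_neg_mul_sum_sq_eq_prod]
  rw [integral_fintype_prod_volume_eq_pow (fun x : ℝ => Real.exp (-b * x ^ 2)), integral_gaussian,
    Fintype.card_fin]

/-- Low frequencies: the multiplier is dominated by a Gaussian. -/
theorem low_frequency_multiplier_le {c s t : ℝ} (hc : 0 < c) (hs : 0 ≤ s) (hs1 : s ≤ 1)
    (ht : 0 ≤ t) (k : ℕ) :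
    s ^ k * Real.exp (-(c * (s / (1 + s) ^ 2) * t))
      ≤ Real.exp (c / 4) * (k.factorial / (c / 8) ^ k) * ((1 + t) ^ k)⁻¹
        * Real.exp (-(c / 8 * (1 + t) * s)) := by
  have ht1 : 0 < 1 + t := by linarith
  have h1 : s / 4 ≤ s / (1 + s) ^ 2 :=
    div_le_div_of_nonneg_left hs (by positivity) (by nlinarith)
  have h2 : Real.exp (-(c * (s / (1 + s) ^ 2) * t))
      ≤ Real.exp (c / 4) * Real.exp (-(c / 8 * ((1 + t) * s)))
        * Real.exp (-(c / 8 * (1 + t) * s)) := by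
    rw [← Real.exp_add, ← Real.exp_add, Real.exp_le_exp]
    have := mul_le_mul_of_nonneg_right (mul_le_mul_of_nonneg_left h1 hc.le) ht
    nlinarith [mul_nonneg hc.le (sub_nonneg.2 hs1)]
  have h3 := pow_mul_exp_neg_mul_le (b := c / 8) (by positivity) (mul_nonneg ht1.le hs) k
  calc s ^ k * Real.exp (-(c * (s / (1 + s) ^ 2) * t))
      ≤ s ^ k * (Real.exp (c / 4) * Real.exp (-(c / 8 * ((1 + t) * s)))
        * Real.exp (-(c / 8 * (1 + t) * s))) := by gcongr
    _ = Real.exp (c / 4) * (((1 + t) * s) ^ k * Real.exp (-(c / 8 * ((1 + t) * s))))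
        * ((1 + t) ^ k)⁻¹ * Real.exp (-(c / 8 * (1 + t) * s)) := by
        rw [mul_pow]
        field_simp
    _ ≤ _ := by gcongr

/-- High frequencies: decay in time is traded for `l` additional powers of `s`. -/
theorem high_frequency_multiplier_le {c s t : ℝ} (hc : 0 < c) (hs1 : 1 ≤ s)
    (ht : 0 ≤ t) (k l : ℕ) :
    s ^ k * Real.exp (-(c * (s / (1 + s) ^ 2) * t))
      ≤ Real.exp (c / 4) * (l.factorial / (c / 4) ^ l) * ((1 + t) ^ l)⁻¹ * s ^ (k + l) := by
  have ht1 : 0 < 1 + t := by linarith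
  have hs : 0 < s := by linarith
  have h1 : 1 / (4 * s) ≤ s / (1 + s) ^ 2 := by
    rw [div_le_div_iff₀ (by positivity) (by positivity)]
    nlinarith
  have h2 : Real.exp (-(c * (s / (1 + s) ^ 2) * t))
      ≤ Real.exp (c / 4) * Real.exp (-(c / 4 * ((1 + t) / s))) := by
    rw [← Real.exp_add, Real.exp_le_exp]
    have h := mul_le_mul_of_nonneg_right (mul_le_mul_of_nonneg_left h1 hc.le) ht
    have h4 : c / 4 * ((1 + t) / s) = c / 4 * (1 / s) + c * (1 / (4 * s)) * t := by
      field_simp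
    have h5 : c / 4 * (1 / s) ≤ c / 4 * 1 := by
      gcongr
      exact (div_le_one hs).2 hs1
    linarith
  have h3 := pow_mul_exp_neg_mul_le (b := c / 4) (by positivity) (div_nonneg ht1.le hs.le) l
  calc s ^ k * Real.exp (-(c * (s / (1 + s) ^ 2) * t))
      ≤ s ^ k * (Real.exp (c / 4) * Real.exp (-(c / 4 * ((1 + t) / s)))) := by gcongr
    _ = Real.exp (c / 4) * (((1 + t) / s) ^ l * Real.exp (-(c / 4 * ((1 + t) / s))))
        * ((1 + t) ^ l)⁻¹ * s ^ (k + l) := by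
        rw [div_pow, pow_add]
        field_simp
    _ ≤ _ := by gcongr

theorem sqrt_pi_div_mul_pow {b T : ℝ} (hb : 0 < b) (hT : 0 < T) (n k : ℕ) :
    (T ^ k)⁻¹ * √(Real.pi / (b * T)) ^ n
      = √(Real.pi / b) ^ n * T ^ (-(n : ℝ) / 2 - k) := by
  have h1 : √T ^ n = T ^ ((n : ℝ) / 2) := by
    rw [Real.sqrt_eq_rpow, ← Real.rpow_natCast, ← Real.rpow_mul hT.le]
    congr 1
    ring
  rw [← div_div, Real.sqrt_div (by positivity), div_pow, h1, Real.rpow_sub hT, neg_div,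
    Real.rpow_neg hT.le, Real.rpow_natCast]
  field_simp

/-- **Decay estimate of the regularity-loss type (proof of (2.6) from (2.5) via Plancherel).**
For every `c > 0` and integers `k, ℓ ≥ 0` there is `C > 0` such that for all
`u₀ ∈ L¹ ∩ L²` with `∫ |ξ|^{2(k+ℓ)}|𝓕u₀(ξ)|² dξ < ∞` and all `t ≥ 0`,
`∫ |ξ|^{2k} e^{−cη(|ξ|)t}|𝓕u₀(ξ)|² dξ ≤ C(1+t)^{−n/2−k}‖u₀‖²_{L¹}
  + C (1+t)^{−ℓ} ∫ |ξ|^{2(k+ℓ)}|𝓕u₀(ξ)|² dξ`, where `η(r) = r²/(1+r²)²`. -/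
theorem frequency_integral_estimate_regularity_loss
    (n m : ℕ) (hn : 1 ≤ n) (hm : 1 ≤ m)
    (c : ℝ) (hc : 0 < c) (k l : ℕ) :
    ∃ C > (0:ℝ),
      ∀ u₀ : (Fin n → ℝ) → (Fin m → ℂ),
        Integrable u₀ →
        MemLp u₀ 2 volume →
        Integrable (fun ξ : Fin n → ℝ =>
          (∑ j, ξ j ^ 2) ^ (k + l) * (∑ i, Complex.normSq (FT u₀ ξ i))) →
        ∀ t : ℝ, 0 ≤ t →
          (∫ ξ : Fin n → ℝ,
              (∑ j, ξ j ^ 2) ^ k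
                * Real.exp (-(c * ((∑ j, ξ j ^ 2) / (1 + ∑ j, ξ j ^ 2) ^ 2) * t))
                * (∑ i, Complex.normSq (FT u₀ ξ i)))
            ≤ C * (1 + t) ^ (-(n : ℝ) / 2 - k) * (∫ x : Fin n → ℝ, cnrm (u₀ x)) ^ 2
              + C * (1 + t) ^ (-(l : ℝ))
                * ∫ ξ : Fin n → ℝ,
                    (∑ j, ξ j ^ 2) ^ (k + l) * (∑ i, Complex.normSq (FT u₀ ξ i)) := by
  set A : ℝ := Real.exp (c / 4) * (k.factorial / (c / 8) ^ k)
  set B : ℝ := Real.exp (c / 4) * (l.factorial / (c / 4) ^ l)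
  set G : ℝ := √(Real.pi / (c / 8)) ^ n
  have hA0 : 0 < A := by positivity
  have hB0 : 0 < B := by positivity
  have hG0 : 0 ≤ G := by positivity
  refine ⟨A * G + B, by positivity, fun u₀ _ _ hint t ht => ?_⟩
  have ht1 : 0 < 1 + t := by linarith
  set M : ℝ := ∫ x : Fin n → ℝ, cnrm (u₀ x)
  set N : (Fin n → ℝ) → ℝ := fun ξ => ∑ i, Complex.normSq (FT u₀ ξ i)
  have hN0 : ∀ ξ, 0 ≤ N ξ := fun ξ => Finset.sum_nonneg fun _ _ => Complex.normSq_nonneg _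
  have hs0 : ∀ ξ : Fin n → ℝ, 0 ≤ ∑ j, ξ j ^ 2 := fun ξ => Finset.sum_nonneg fun _ _ => sq_nonneg _
  set J : ℝ := ∫ ξ : Fin n → ℝ, (∑ j, ξ j ^ 2) ^ (k + l) * N ξ
  have hJ0 : 0 ≤ J := integral_nonneg fun ξ => mul_nonneg (pow_nonneg (hs0 ξ) _) (hN0 ξ)
  have hlow := (integrable_exp_neg_mul_sum_sq (n := n) (b := c / 8 * (1 + t))
    (by positivity)).const_mul (A * ((1 + t) ^ k)⁻¹ * M ^ 2)
  have hhigh := hint.const_mul (B * ((1 + t) ^ l)⁻¹)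
  calc _ ≤ ∫ ξ : Fin n → ℝ,
        (A * ((1 + t) ^ k)⁻¹ * M ^ 2 * Real.exp (-(c / 8 * (1 + t) * ∑ j, ξ j ^ 2))
          + B * ((1 + t) ^ l)⁻¹ * ((∑ j, ξ j ^ 2) ^ (k + l) * N ξ)) := by
        refine integral_mono_of_nonneg (Filter.Eventually.of_forall fun ξ => ?_)
          (hlow.add hhigh) (Filter.Eventually.of_forall fun ξ => ?_)
        · exact mul_nonneg (mul_nonneg (pow_nonneg (hs0 ξ) _) (Real.exp_pos _).le) (hN0 ξ)
        · have hs := hs0 ξ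
          have hNξ := hN0 ξ
          have hNM : N ξ ≤ M ^ 2 := sum_normSq_FT_le u₀ ξ
          change (∑ j, ξ j ^ 2) ^ k
            * Real.exp (-(c * ((∑ j, ξ j ^ 2) / (1 + ∑ j, ξ j ^ 2) ^ 2) * t)) * N ξ
              ≤ A * ((1 + t) ^ k)⁻¹ * M ^ 2 * Real.exp (-(c / 8 * (1 + t) * ∑ j, ξ j ^ 2))
                + B * ((1 + t) ^ l)⁻¹ * ((∑ j, ξ j ^ 2) ^ (k + l) * N ξ)
          generalize ∑ j, ξ j ^ 2 = s at hs ⊢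
          rcases le_total s 1 with h | h
          · refine le_add_of_le_of_nonneg ?_ (by positivity)
            calc _ ≤ A * ((1 + t) ^ k)⁻¹ * Real.exp (-(c / 8 * (1 + t) * s)) * M ^ 2 :=
                  mul_le_mul (low_frequency_multiplier_le hc hs h ht k) hNM hNξ (by positivity)
              _ = _ := by ring
          · refine le_add_of_nonneg_of_le (by positivity) ?_
            calc _ ≤ B * ((1 + t) ^ l)⁻¹ * s ^ (k + l) * N ξ :=
                  mul_le_mul_of_nonneg_right (high_frequency_multiplier_le hc h ht k l) hNξ
              _ = _ := by ring
    _ = A * G * (1 + t) ^ (-(n : ℝ) / 2 - k) * M ^ 2 + B * (1 + t) ^ (-(l : ℝ)) * J := by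
        rw [integral_add hlow hhigh, integral_const_mul, integral_const_mul,
          integral_exp_neg_mul_sum_sq, Real.rpow_neg ht1.le, Real.rpow_natCast]
        have h := sqrt_pi_div_mul_pow (b := c / 8) (by positivity) ht1 n k
        linear_combination (A * M ^ 2) * h
    _ ≤ (A * G + B) * (1 + t) ^ (-(n : ℝ) / 2 - k) * M ^ 2
          + (A * G + B) * (1 + t) ^ (-(l : ℝ)) * J := by
        have hAG : 0 ≤ A * G := by positivity
        gcongr
        · linarith
        · linarith
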